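/- Let $\mathbb{K}$ be a field of characteristic zero. An almost Poisson algebra $(A,[\cdot,\cdot],\cdot)$ over $\mathbb{K}$ is a $\mathbb{K}$-vector space $A$ with a bilinear, commutative and associative product $\cdot$ and a skew-symmetric bilinear bracket $[\cdot,\cdot]$ such that $[x,y\cdot z]=[x,y]\cdot z+y\cdot[x,z]$ for all $x,y,z\in A$. Let $A$ be a $\mathbb{K}$-vector space with bilinear operations $[\cdot,\cdot]$, $\diamond$, $\cdot$, $\vartriangleright$, and put $$x*y = x\vartriangleright y+y\vartriangleright x+x\cdot y,\qquad \{x,y\}=x\diamond y-y\diamond x+[x,y].$$ The tuple $(A,[\cdot,\cdot],\diamond,\cdot,\vartriangleright)$ is called an almost tridendriform Poisson algebra if $(A,[\cdot,\cdot],\cdot)$ is an almost Poisson algebra, $(A,\cdot,\vartriangleright)$ is a commutative dendriform trialgebra, that is, $\cdot$ is commutative and associative and for all $x,y,z\in A$ $$(x*y)\vartriangleright z=x\vartriangleright(y\vartriangleright z),\qquad (x\vartriangleright y)\cdot z=x\vartriangleright(y\cdot z),$$ and for all $x,y,z\in A$ \begin{align*} x\diamond(y\cdot z)&=(x\diamond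 y)\cdot z+y\cdot(x\diamond z),\\ [x,z\vartriangleright y]&=z\vartriangleright[x,y]-y\cdot(z\diamond x),\\ (y*z)\diamond x&=z\vartriangleright(y\diamond x)+y\vartriangleright(z\diamond x),\\ \{x,z\}\vartriangleright y&=x\diamond(z\vartriangleright y)-z\vartriangleright(x\diamond y). \end{align*} Let $(A,[\cdot,\cdot],\diamond,\cdot,\vartriangleright)$ be an almost tridendriform Poisson algebra. Then $A$ with the product $*$ and the bracket $\{\cdot,\cdot\}$ is an almost Poisson algebra (the associated almost Poisson algebra $A^C$ of $A$). -/

import Mathlib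

/-- A commutative associative algebra `(A, m)` (no unit is required). -/
def IsCommAssoc (K : Type*) [Field K] {A : Type*} [AddCommGroup A] [Module K A]
    (m : A → A → A) : Prop :=
  IsBilinearMap K m ∧ (∀ x y, m x y = m y x) ∧ (∀ x y z, m (m x y) z = m x (m y z))

/-- An almost Poisson algebra `(A, br, m)`: `m` is the product, `br` the bracket. -/
def IsAlmostPoisson (K : Type*) [Field K] {A : Type*} [AddCommGroup A] [Module K A]
    (br m : A → A → A) : Prop :=
  IsCommAssoc K m ∧ IsBilinearMap K br ∧ (∀ x y, br x y = - br y x) ∧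
  (∀ x y z, br x (m y z) = m (br x y) z + m y (br x z))

/-- The induced product `x ∗ y = x ▷ y + y ▷ x + x · y`, with `m` for `·` and `tr` for `▷`. -/
def inducedMul {A : Type*} [AddCommGroup A] (m tr : A → A → A) (x y : A) : A :=
  tr x y + tr y x + m x y

/-- The induced bracket `{x, y} = x ◇ y - y ◇ x + [x, y]`, with `br` for `[·,·]` and
`dia` for `◇`. -/
def inducedBracket {A : Type*} [AddCommGroup A] (br dia : A → A → A) (x y : A) : A :=
  dia x y - dia y x + br x y

/-- A commutative dendriform trialgebra `(A, m, tr)`: `(A, m)` is commutative associative,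
`(x ∗ y) ▷ z = x ▷ (y ▷ z)` for the induced product `∗`, and `(x ▷ y) · z = x ▷ (y · z)`. -/
def IsCDT (K : Type*) [Field K] {A : Type*} [AddCommGroup A] [Module K A]
    (m tr : A → A → A) : Prop :=
  IsCommAssoc K m ∧ IsBilinearMap K tr ∧
  (∀ x y z, tr (inducedMul m tr x y) z = tr x (tr y z)) ∧
  (∀ x y z, m (tr x y) z = tr x (m y z))

/-- An almost tridendriform Poisson algebra `(A, br, dia, m, tr)`. The third compatibility
condition is `(y ∗ z) ◇ x = z ▷ (y ◇ x) + y ▷ (z ◇ x)` for the induced product `∗`. -/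
def IsATP (K : Type*) [Field K] {A : Type*} [AddCommGroup A] [Module K A]
    (br dia m tr : A → A → A) : Prop :=
  IsAlmostPoisson K br m ∧ IsCDT K m tr ∧ IsBilinearMap K dia ∧
  (∀ x y z, dia x (m y z) = m (dia x y) z + m y (dia x z)) ∧
  (∀ x y z, br x (tr z y) = tr z (br x y) - m y (dia z x)) ∧
  (∀ x y z, dia (inducedMul m tr y z) x = tr z (dia y x) + tr y (dia z x)) ∧
  (∀ x y z, tr (inducedBracket br dia x z) y = dia x (tr z y) - tr z (dia x y))

theorem IsBilinearMap.add_add {K A : Type*} [Field K] [AddCommGroup A] [Module K A]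
    {f g : A → A → A} (hf : IsBilinearMap K f) (hg : IsBilinearMap K g) :
    IsBilinearMap K (fun x y => f x y + g x y) where
  add_left x₁ x₂ y := by rw [hf.add_left, hg.add_left]; abel
  smul_left c x y := by rw [hf.smul_left, hg.smul_left, smul_add]
  add_right x y₁ y₂ := by rw [hf.add_right, hg.add_right]; abel
  smul_right c x y := by rw [hf.smul_right, hg.smul_right, smul_add]

theorem IsBilinearMap.swap {K A : Type*} [Field K] [AddCommGroup A] [Module K A]
    {f : A → A → A} (hf : IsBilinearMap K f) : IsBilinearMap K (fun x y => f y x) where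
  add_left x₁ x₂ y := hf.add_right y x₁ x₂
  smul_left c x y := hf.smul_right c y x
  add_right x y₁ y₂ := hf.add_left y₁ y₂ x
  smul_right c x y := hf.smul_left c y x

theorem IsBilinearMap.neg_apply {K A : Type*} [Field K] [AddCommGroup A] [Module K A]
    {f : A → A → A} (hf : IsBilinearMap K f) : IsBilinearMap K (fun x y => -f x y) where
  add_left x₁ x₂ y := by rw [hf.add_left, neg_add]
  smul_left c x y := by rw [hf.smul_left, smul_neg]
  add_right x y₁ y₂ := by rw [hf.add_right, neg_add]
  smul_right c x y := by rw [hf.smul_right, smul_neg]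

theorem IsBilinearMap.map_sub_left {K A : Type*} [Field K] [AddCommGroup A] [Module K A]
    {f : A → A → A} (hf : IsBilinearMap K f) (x y z : A) : f (x - y) z = f x z - f y z := by
  rw [eq_sub_iff_add_eq, ← hf.add_left, sub_add_cancel]

theorem IsBilinearMap.map_sub_right {K A : Type*} [Field K] [AddCommGroup A] [Module K A]
    {f : A → A → A} (hf : IsBilinearMap K f) (x y z : A) : f x (y - z) = f x y - f x z :=
  hf.swap.map_sub_left y z x

theorem isBilinearMap_inducedMul {K A : Type*} [Field K] [AddCommGroup A] [Module K A]
    {m tr : A → A → A} (hm : IsBilinearMap K m) (ht : IsBilinearMap K tr) :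
    IsBilinearMap K (inducedMul m tr) :=
  (ht.add_add ht.swap).add_add hm

theorem isBilinearMap_inducedBracket {K A : Type*} [Field K] [AddCommGroup A] [Module K A]
    {br dia : A → A → A} (hb : IsBilinearMap K br) (hd : IsBilinearMap K dia) :
    IsBilinearMap K (inducedBracket br dia) := by
  have h := (hd.add_add hd.swap.neg_apply).add_add hb
  simp only [← sub_eq_add_neg] at h
  exact h

/-- The induced product of a commutative dendriform trialgebra is commutative and associative. -/
theorem IsCDT.isCommAssoc_inducedMul {K A : Type*} [Field K] [AddCommGroup A] [Module K A]
    {m tr : A → A → A} (h : IsCDT K m tr) : IsCommAssoc K (inducedMul m tr) := by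
  obtain ⟨⟨hm, hcomm, hassoc⟩, ht, htr, hmt⟩ := h
  have hc : ∀ x y, inducedMul m tr x y = inducedMul m tr y x := fun x y => by
    simp only [inducedMul, hcomm x y]; abel
  have hswap : ∀ x y z, tr x (tr y z) = tr y (tr x z) := fun x y z => by
    rw [← htr, hc, htr]
  have hmt' : ∀ x y z, m x (tr y z) = tr y (m x z) := fun x y z => by
    rw [hcomm, hmt, hcomm]
  refine ⟨isBilinearMap_inducedMul hm ht, hc, fun x y z => ?_⟩
  have e₁ : inducedMul m tr (inducedMul m tr x y) z =
      tr x (tr y z) + tr z (inducedMul m tr x y) + m (inducedMul m tr x y) z := by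
    rw [← htr]; rfl
  have e₂ : inducedMul m tr x (inducedMul m tr y z) =
      tr x (inducedMul m tr y z) + tr y (tr z x) + m x (inducedMul m tr y z) := by
    rw [← htr]; rfl
  rw [e₁, e₂]
  simp only [inducedMul, ht.add_right, hm.add_left, hm.add_right, hmt, hmt', hassoc]
  rw [hswap z x y, hswap z y x, hcomm x z]
  abel

/-- The induced operations of an almost tridendriform Poisson algebra satisfy the Leibniz rule. -/
theorem IsATP.leibniz {K A : Type*} [Field K] [AddCommGroup A] [Module K A]
    {br dia m tr : A → A → A} (h : IsATP K br dia m tr) (x y z : A) :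
    inducedBracket br dia x (inducedMul m tr y z) =
      inducedMul m tr (inducedBracket br dia x y) z +
        inducedMul m tr y (inducedBracket br dia x z) := by
  obtain ⟨⟨⟨hm, hcomm, -⟩, hb, -, hbm⟩, ⟨-, ht, -, -⟩, hd, hdm, hbt, hmd, htb⟩ := h
  have e₁ : inducedBracket br dia x (inducedMul m tr y z) =
      dia x (inducedMul m tr y z) - (tr z (dia y x) + tr y (dia z x)) +
        br x (inducedMul m tr y z) := by
    rw [← hmd]; rfl
  have e₂ : inducedMul m tr (inducedBracket br dia x y) z =
      (dia x (tr y z) - tr y (dia x z)) + tr z (inducedBracket br dia x y) +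
        m (inducedBracket br dia x y) z := by
    rw [← htb]; rfl
  have e₃ : inducedMul m tr y (inducedBracket br dia x z) =
      tr y (inducedBracket br dia x z) + (dia x (tr z y) - tr z (dia x y)) +
        m y (inducedBracket br dia x z) := by
    rw [← htb]; rfl
  rw [e₁, e₂, e₃]
  simp only [inducedMul, inducedBracket, hd.add_right, hb.add_right, ht.add_right, hm.add_left,
    hm.add_right, ht.map_sub_right, hm.map_sub_left, hm.map_sub_right, hdm, hbm, hbt]
  rw [hcomm z (dia y x)]
  abel

/-- The associated almost Poisson algebra `A^C` of an almost tridendriform Poisson algebra. -/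
theorem stmt8 {K A : Type*} [Field K] [CharZero K] [AddCommGroup A] [Module K A]
    (br dia m tr : A → A → A) (h : IsATP K br dia m tr) :
    IsAlmostPoisson K (inducedBracket br dia) (inducedMul m tr) := by
  obtain ⟨⟨-, hb, hskew, -⟩, hcdt, hd, -⟩ := id h
  refine ⟨hcdt.isCommAssoc_inducedMul, isBilinearMap_inducedBracket hb hd, fun x y => ?_,
    h.leibniz⟩
  simp only [inducedBracket, hskew x y]
  abel
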